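/- For every integer p ≥ 1 there exist nonzero elements a, b of Λ₄ such that Ψ_S^{2p} = a·1 + b·(u₁·u₂) in Q. (In the paper's language: Ψ_S^{2p} lies in the Λ-span of (11 1̄1̄) and (00 1̄1̄), with both coordinates nonvanishing.) -/

import Mathlib

/- Λ₄ is the group algebra of ℝ⁴ over ℝ; `E β` is the Novikov monomial e^β,
   δ i the standard basis vectors of ℝ⁴.  `Q` is the Künneth model of the
   quantum homology of M = (S²×S²)×(S²×S²) with form (ω₀⊕λω₀)⊕(−ω₀⊕−λω₀):
   the quotient of Λ₄[U₁,U₂,U₃,U₄] by U₁²−e^{−δ₁}, U₂²−e^{−δ₂}, U₃²−e^{δ₃},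
   U₄²−e^{δ₄}; `u i` are the images of the variables (u₁,u₂,w₃,w₄). -/

noncomputable section

abbrev Λ₄ : Type := AddMonoidAlgebra ℝ (Fin 4 → ℝ)

def E (β : Fin 4 → ℝ) : Λ₄ := AddMonoidAlgebra.single β 1

def δ (i : Fin 4) : Fin 4 → ℝ := Pi.single i 1

def qRel : Ideal (MvPolynomial (Fin 4) Λ₄) :=
  Ideal.span {MvPolynomial.X 0 ^ 2 - MvPolynomial.C (E (-δ 0)),
              MvPolynomial.X 1 ^ 2 - MvPolynomial.C (E (-δ 1)),
              MvPolynomial.X 2 ^ 2 - MvPolynomial.C (E (δ 2)),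
              MvPolynomial.X 3 ^ 2 - MvPolynomial.C (E (δ 3))}

abbrev Q : Type := MvPolynomial (Fin 4) Λ₄ ⧸ qRel

def u (i : Fin 4) : Q := Ideal.Quotient.mk qRel (MvPolynomial.X i)

def eQ (β : Fin 4 → ℝ) : Q := algebraMap Λ₄ Q (E β)

/-- Ψ_S = (u₁+u₂)·e^{(1/2+h)δ₁−hδ₂} -/
def ΨS (h : ℝ) : Q := (u 0 + u 1) * eQ ((1 / 2 + h) • δ 0 - h • δ 1)

/-- Ψ_T = −(w₃+w₄)·e^{−(1/2+h)δ₃+hδ₄} -/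
def ΨT (h : ℝ) : Q := -((u 2 + u 3) * eQ (-((1 / 2 + h) • δ 2) + h • δ 3))

/-- Ψ_{S'} = (u₁−w₄)·e^{(1/2+h)δ₁+hδ₄} -/
def ΨS' (h : ℝ) : Q := (u 0 - u 3) * eQ ((1 / 2 + h) • δ 0 + h • δ 3)

/-- Ψ_{T'} = (u₂−w₃)·e^{−(1/2+h)δ₃−hδ₂} -/
def ΨT' (h : ℝ) : Q := (u 1 - u 2) * eQ (-((1 / 2 + h) • δ 2) - h • δ 1)

/-- The augmentation `Λ₄ → ℝ` sending every monomial `e^β` to `1`. -/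
def augmentation : Λ₄ →ₐ[ℝ] ℝ := AddMonoidAlgebra.lift ℝ ℝ (Fin 4 → ℝ) 1

@[simp]
theorem augmentation_E (β : Fin 4 → ℝ) : augmentation (E β) = 1 := by
  simp [augmentation, E]

theorem u_zero_sq : u 0 ^ 2 = eQ (-δ 0) := by
  have h : MvPolynomial.X 0 ^ 2 - MvPolynomial.C (E (-δ 0)) ∈ qRel :=
    Ideal.subset_span (by simp)
  exact Ideal.Quotient.eq.mpr h

theorem u_one_sq : u 1 ^ 2 = eQ (-δ 1) := by
  have h : MvPolynomial.X 1 ^ 2 - MvPolynomial.C (E (-δ 1)) ∈ qRel :=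
    Ideal.subset_span (by simp)
  exact Ideal.Quotient.eq.mpr h

theorem ΨS_sq (h : ℝ) :
    ΨS h ^ 2 = eQ ((1 / 2 + h) • δ 0 - h • δ 1) ^ 2 *
      (eQ (-δ 0) + eQ (-δ 1) + 2 * (u 0 * u 1)) := by
  rw [← u_zero_sq, ← u_one_sq, ΨS]
  ring

theorem exists_ΨS_pow_eq_of_augmentation_pos (h : ℝ) (p : ℕ) (hp : 1 ≤ p) :
    ∃ a b : Λ₄, 0 < augmentation a ∧ 0 < augmentation b ∧
      ΨS h ^ (2 * p) = algebraMap Λ₄ Q a + algebraMap Λ₄ Q b * (u 0 * u 1) := by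
  set m := E ((1 / 2 + h) • δ 0 - h • δ 1) with hm
  have hmQ : eQ ((1 / 2 + h) • δ 0 - h • δ 1) = algebraMap Λ₄ Q m := rfl
  induction p, hp using Nat.le_induction with
  | base =>
    refine ⟨m ^ 2 * (E (-δ 0) + E (-δ 1)), m ^ 2 * 2, by simp [hm],
      by simp [hm, map_ofNat augmentation 2], ?_⟩
    rw [mul_one, ΨS_sq, hmQ]
    simp only [eQ, map_mul, map_add, map_pow, map_ofNat]
    ring
  | succ p _ ih =>
    obtain ⟨a, b, ha, hb, hab⟩ := ih
    refine ⟨m ^ 2 * (a * (E (-δ 0) + E (-δ 1)) + 2 * b * (E (-δ 0) * E (-δ 1))),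
      m ^ 2 * (2 * a + b * (E (-δ 0) + E (-δ 1))), ?_, ?_, ?_⟩
    · simp only [map_mul, map_add, map_pow, map_ofNat, hm, augmentation_E]
      linarith
    · simp only [map_mul, map_add, map_pow, map_ofNat, hm, augmentation_E]
      linarith
    · have h0 : u 0 ^ 2 = algebraMap Λ₄ Q (E (-δ 0)) := u_zero_sq
      have h1 : u 1 ^ 2 = algebraMap Λ₄ Q (E (-δ 1)) := u_one_sq
      rw [mul_add, mul_one, pow_add, hab, ΨS_sq, hmQ]
      simp only [eQ, map_mul, map_add, map_pow, map_ofNat]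
      rw [← h0, ← h1]
      ring

/-- For every p ≥ 1, Ψ_S^{2p} = a·1 + b·(u₁·u₂) in Q with a, b nonzero in Λ₄. -/
theorem psiS_even_powers_two_nonzero_coords
    (lam : ℝ) (hlam : 1 < lam) (h : ℝ) (hh : h = 1 / (6 * lam * (lam - 1)))
    (p : ℕ) (hp : 1 ≤ p) :
    ∃ a b : Λ₄, a ≠ 0 ∧ b ≠ 0 ∧
      ΨS h ^ (2 * p) = algebraMap Λ₄ Q a * 1 + algebraMap Λ₄ Q b * (u 0 * u 1) := by
  obtain ⟨a, b, ha, hb, hab⟩ := exists_ΨS_pow_eq_of_augmentation_pos h p hp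
  refine ⟨a, b, ?_, ?_, by rw [hab, mul_one]⟩
  · rintro rfl
    simp at ha
  · rintro rfl
    simp at hb

end
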